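/- arXiv:1702.04083 — 2 statements merged into one kernel-verified Lean document; each statement's English description precedes it below -/
import Mathlib

section
/- (Lax inequalities for the forward shock in the concave region.) Let ρ > 0 and T < T_l < 0. Then ε'(T_l) < (ε(T) − ε(T_l))/(T − T_l) < ε'(T); consequently the forward shock speed s₂ = 1/√(ρ·(ε(T) − ε(T_l))/(T − T_l)) satisfies λ₂(T_l) > s₂ > λ₂(T), where λ₂(x) = 1/√(ρ ε'(x)). -/
/-- The strain–stress function `ε(T) = βT + α(1 + (γ/2)T²)ⁿ T`,
where the power with real exponent is `Real.rpow`. -/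
noncomputable def eps (α β γ n : ℝ) : ℝ → ℝ :=
  fun T => β * T + α * (1 + γ / 2 * T ^ 2) ^ n * T

theorem hasDerivAt_eps (α β n T : ℝ) {γ : ℝ} (hγ : 0 < γ) :
    HasDerivAt (eps α β γ n)
      (β + α * ((1 + γ / 2 * T ^ 2) ^ n * (1 + 2 * n * (1 - (1 + γ / 2 * T ^ 2)⁻¹)))) T := by
  have hu : 0 < 1 + γ / 2 * T ^ 2 := by positivity
  have hbase : HasDerivAt (fun x : ℝ => 1 + γ / 2 * x ^ 2) (γ * T) T := by
    have h := ((hasDerivAt_pow 2 T).const_mul (γ / 2)).const_add 1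
    refine h.congr_deriv ?_
    norm_num
    ring
  have hpow := hbase.rpow_const (p := n) (Or.inl hu.ne')
  have h := ((hasDerivAt_id T).const_mul β).add ((hpow.const_mul α).mul (hasDerivAt_id T))
  refine h.congr_deriv ?_
  rw [Real.rpow_sub_one hu.ne']
  simp only [id]
  field_simp
  ring

/-- The derivative of `eps` is strictly decreasing on the negative half-line. -/
theorem deriv_eps_lt {α β γ n x y : ℝ} (hα : 0 < α) (hγ : 0 < γ) (hn : 0 < n)
    (hxy : x < y) (hy : y < 0) : deriv (eps α β γ n) y < deriv (eps α β γ n) x := by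
  rw [(hasDerivAt_eps α β n x hγ).deriv, (hasDerivAt_eps α β n y hγ).deriv]
  have hsq : y ^ 2 < x ^ 2 := by nlinarith
  have hv : 1 ≤ 1 + γ / 2 * y ^ 2 := le_add_of_nonneg_right (by positivity)
  have huv : 1 + γ / 2 * y ^ 2 < 1 + γ / 2 * x ^ 2 := by gcongr
  generalize 1 + γ / 2 * y ^ 2 = v at hv huv ⊢
  generalize 1 + γ / 2 * x ^ 2 = u at huv ⊢
  have hv0 : 0 < v := by linarith
  have hinv : u⁻¹ ≤ v⁻¹ := by gcongr
  have hv1 : v⁻¹ ≤ 1 := inv_le_one_of_one_le₀ hv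
  have hfac : 0 < 1 + 2 * n * (1 - v⁻¹) := by nlinarith
  have hle : 1 + 2 * n * (1 - v⁻¹) ≤ 1 + 2 * n * (1 - u⁻¹) := by gcongr
  have hpow : v ^ n < u ^ n := Real.rpow_lt_rpow hv0.le huv hn
  have := mul_lt_mul hpow hle hfac (Real.rpow_nonneg (hv0.le.trans huv.le) n)
  gcongr

theorem deriv_eps_pos {α β γ n : ℝ} (hα : 0 < α) (hγ : 0 < γ) (hn : 0 < n) (hαβ : 0 < α + β)
    (T : ℝ) : 0 < deriv (eps α β γ n) T := by
  rw [(hasDerivAt_eps α β n T hγ).deriv]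
  have hu : 1 ≤ 1 + γ / 2 * T ^ 2 := le_add_of_nonneg_right (by positivity)
  generalize 1 + γ / 2 * T ^ 2 = u at hu ⊢
  have hpow : 1 ≤ u ^ n := Real.one_le_rpow hu hn.le
  have hinv : u⁻¹ ≤ 1 := inv_le_one_of_one_le₀ hu
  have hfac : 1 ≤ 1 + 2 * n * (1 - u⁻¹) := by nlinarith
  have hmul := one_le_mul_of_one_le_of_one_le hpow hfac
  nlinarith

theorem one_div_sqrt_mul_lt {ρ a b : ℝ} (hρ : 0 < ρ) (ha : 0 < a) (hab : a < b) :
    1 / Real.sqrt (ρ * b) < 1 / Real.sqrt (ρ * a) :=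
  one_div_lt_one_div_of_lt (Real.sqrt_pos.2 (mul_pos hρ ha))
    (Real.sqrt_lt_sqrt (mul_pos hρ ha).le (mul_lt_mul_of_pos_left hab hρ))

/-- Lax inequalities for the forward shock in the concave region: for
`T < T_l < 0`, `ε'(T_l) < (ε(T) − ε(T_l))/(T − T_l) < ε'(T)`, so the forward
shock speed `s₂ = 1/√(ρ (ε(T) − ε(T_l))/(T − T_l))` satisfies
`λ₂(T_l) > s₂ > λ₂(T)`. -/
theorem stmt_14 (α β γ n ρ Tl T : ℝ) (hα : 0 < α) (hβ : β < 0) (hγ : 0 < γ)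
    (hn : 0 < n) (hαβ : 0 < α + β) (hρ : 0 < ρ) (hT : T < Tl) (hTl : Tl < 0) :
    deriv (eps α β γ n) Tl < (eps α β γ n T - eps α β γ n Tl) / (T - Tl) ∧
    (eps α β γ n T - eps α β γ n Tl) / (T - Tl) < deriv (eps α β γ n) T ∧
    1 / Real.sqrt (ρ * ((eps α β γ n T - eps α β γ n Tl) / (T - Tl))) <
      1 / Real.sqrt (ρ * deriv (eps α β γ n) Tl) ∧
    1 / Real.sqrt (ρ * deriv (eps α β γ n) T) <
      1 / Real.sqrt (ρ * ((eps α β γ n T - eps α β γ n Tl) / (T - Tl))) := by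
  obtain ⟨c, ⟨hTc, hcTl⟩, hc⟩ := exists_deriv_eq_slope (eps α β γ n) hT
    (fun x _ => (hasDerivAt_eps α β n x hγ).continuousAt.continuousWithinAt)
    (fun x _ => (hasDerivAt_eps α β n x hγ).differentiableAt.differentiableWithinAt)
  have hslope : (eps α β γ n T - eps α β γ n Tl) / (T - Tl) = deriv (eps α β γ n) c := by
    rw [hc, ← neg_div_neg_eq, neg_sub, neg_sub]
  rw [hslope]
  have h1 : deriv (eps α β γ n) Tl < deriv (eps α β γ n) c := deriv_eps_lt hα hγ hn hcTl hTl
  have h2 : deriv (eps α β γ n) c < deriv (eps α β γ n) T :=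
    deriv_eps_lt hα hγ hn hTc (hcTl.trans hTl)
  exact ⟨h1, h2, one_div_sqrt_mul_lt hρ (deriv_eps_pos hα hγ hn hαβ Tl) h1,
    one_div_sqrt_mul_lt hρ (deriv_eps_pos hα hγ hn hαβ c) h2⟩
end

section
/- (Regularity and monotonicity of the composite forward wave curve.) Let ρ > 0, T_l < 0, v_l ∈ ℝ, and define W₂ : (T_l, ∞) → ℝ by W₂(T) = v_l − ∫_{T_l}^{T} √(ε'(τ)/ρ) dτ for T_l < T ≤ 0 and W₂(T) = v_l − ∫_{T_l}^{0} √(ε'(τ)/ρ) dτ − √(T·ε(T)/ρ) for T > 0. Then W₂ is continuous and strictly decreasing on (T_l, ∞), and continuously differentiable there; in particular W₂ is differentiable at T = 0 with W₂'(0) = −√((α + β)/ρ), i.e. the left derivative −√(ε'(0)/ρ) and the right derivative lim_{T→0⁺} −(ε(T) + T ε'(T))/(2√(ρ T ε(T))) coincide. -/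
/-- The composite forward wave curve issuing from `(T_l, v_l)` with `T_l < 0`:
a rarefaction branch `W₂(T) = v_l − ∫_{T_l}^{T} √(ε'(τ)/ρ) dτ` for `T ≤ 0`,
followed by a degenerate shock branch
`W₂(T) = v_l − ∫_{T_l}^{0} √(ε'(τ)/ρ) dτ − √(T ε(T)/ρ)` for `T > 0`. -/
noncomputable def W2 (α β γ n ρ Tl vl : ℝ) : ℝ → ℝ := fun T =>
  if T ≤ 0 then vl - ∫ τ in Tl..T, Real.sqrt (deriv (eps α β γ n) τ / ρ)
  else vl - (∫ τ in Tl..(0 : ℝ), Real.sqrt (deriv (eps α β γ n) τ / ρ)) -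
    Real.sqrt (T * eps α β γ n T / ρ)

/-- The secant modulus `ε(T) / T = β + α(1 + (γ/2)T²)ⁿ`. -/
noncomputable def epsSecant (α β γ n : ℝ) : ℝ → ℝ :=
  fun T => β + α * (1 + γ / 2 * T ^ 2) ^ n

/-- The derivative of `epsSecant`. -/
noncomputable def epsSecantDeriv (α γ n : ℝ) : ℝ → ℝ :=
  fun T => α * (γ * T * n * (1 + γ / 2 * T ^ 2) ^ (n - 1))

/-- The negated slope of the shock branch of the wave curve. -/
noncomputable def shockSlope (α β γ n ρ : ℝ) : ℝ → ℝ := fun T =>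
  (2 * epsSecant α β γ n T + T * epsSecantDeriv α γ n T) /
    (2 * Real.sqrt (ρ * epsSecant α β γ n T))

/-- The negated slope of the composite wave curve. -/
noncomputable def waveSlope (α β γ n ρ : ℝ) : ℝ → ℝ := fun T =>
  if T ≤ 0 then Real.sqrt (deriv (eps α β γ n) T / ρ) else shockSlope α β γ n ρ T

theorem eps_eq_mul_epsSecant (α β γ n T : ℝ) :
    eps α β γ n T = T * epsSecant α β γ n T := by
  simp only [eps, epsSecant]
  ring

theorem one_le_base {γ : ℝ} (hγ : 0 < γ) (T : ℝ) : 1 ≤ 1 + γ / 2 * T ^ 2 :=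
  le_add_of_nonneg_right (by positivity)

theorem epsSecant_pos {α β γ n : ℝ} (hα : 0 < α) (hγ : 0 < γ) (hn : 0 < n)
    (hαβ : 0 < α + β) (T : ℝ) : 0 < epsSecant α β γ n T := by
  have h := Real.one_le_rpow (one_le_base hγ T) hn.le
  simp only [epsSecant]
  nlinarith

theorem mul_epsSecantDeriv_nonneg {α γ n : ℝ} (hα : 0 < α) (hγ : 0 < γ) (hn : 0 < n)
    (T : ℝ) : 0 ≤ T * epsSecantDeriv α γ n T := by
  have hB : 0 < 1 + γ / 2 * T ^ 2 := one_pos.trans_le (one_le_base hγ T)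
  have h : T * epsSecantDeriv α γ n T =
      α * (γ * T ^ 2 * n * (1 + γ / 2 * T ^ 2) ^ (n - 1)) := by
    simp only [epsSecantDeriv]
    ring
  rw [h]
  positivity

theorem hasDerivAt_epsSecant (α β n : ℝ) {γ : ℝ} (hγ : 0 < γ) (T : ℝ) :
    HasDerivAt (epsSecant α β γ n) (epsSecantDeriv α γ n T) T := by
  have hB : 0 < 1 + γ / 2 * T ^ 2 := one_pos.trans_le (one_le_base hγ T)
  have h1 : HasDerivAt (fun T : ℝ => 1 + γ / 2 * T ^ 2) (γ * T) T := by
    refine (((hasDerivAt_pow 2 T).const_mul (γ / 2)).const_add 1).congr_deriv ?_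
    norm_num
    ring
  exact ((h1.rpow_const (p := n) (Or.inl hB.ne')).const_mul α).const_add β

theorem continuous_epsSecant (α β n : ℝ) {γ : ℝ} (hγ : 0 < γ) :
    Continuous (epsSecant α β γ n) :=
  continuous_iff_continuousAt.2 fun T => (hasDerivAt_epsSecant α β n hγ T).continuousAt

theorem continuous_epsSecantDeriv (α n : ℝ) {γ : ℝ} (hγ : 0 < γ) :
    Continuous (epsSecantDeriv α γ n) := by
  have h : Continuous fun T : ℝ => (1 + γ / 2 * T ^ 2) ^ (n - 1) :=
    (by fun_prop : Continuous fun T : ℝ => 1 + γ / 2 * T ^ 2).rpow_const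
      fun T => Or.inl (one_pos.trans_le (one_le_base hγ T)).ne'
  unfold epsSecantDeriv
  fun_prop

theorem deriv_eps (α β n : ℝ) {γ : ℝ} (hγ : 0 < γ) (T : ℝ) :
    deriv (eps α β γ n) T = epsSecant α β γ n T + T * epsSecantDeriv α γ n T := by
  have h := (hasDerivAt_id T).mul (hasDerivAt_epsSecant α β n hγ T)
  have he : eps α β γ n = id * epsSecant α β γ n :=
    funext fun T => eps_eq_mul_epsSecant α β γ n T
  rw [he, h.deriv]
  simp

theorem deriv_eps_zero (α β n : ℝ) {γ : ℝ} (hγ : 0 < γ) :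
    deriv (eps α β γ n) 0 = α + β := by
  rw [deriv_eps α β n hγ]
  simp [epsSecant, add_comm]

theorem shockSlope_zero {α β ρ : ℝ} (γ n : ℝ) (hαβ : 0 < α + β) (hρ : 0 < ρ) :
    shockSlope α β γ n ρ 0 = Real.sqrt ((α + β) / ρ) := by
  have hg : epsSecant α β γ n 0 = α + β := by simp [epsSecant, add_comm]
  have hs := Real.sqrt_pos.2 hαβ
  have hr := Real.sqrt_pos.2 hρ
  rw [shockSlope, hg, Real.sqrt_mul hρ.le, Real.sqrt_div hαβ.le]
  field_simp
  rw [Real.sq_sqrt hαβ.le]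
  ring

theorem continuous_shockSlope {α β γ n ρ : ℝ} (hα : 0 < α) (hγ : 0 < γ) (hn : 0 < n)
    (hαβ : 0 < α + β) (hρ : 0 < ρ) : Continuous (shockSlope α β γ n ρ) := by
  have hg := continuous_epsSecant α β n hγ
  have hg' := continuous_epsSecantDeriv α n hγ
  refine Continuous.div (by fun_prop) (by fun_prop) fun T => ?_
  have := epsSecant_pos hα hγ hn hαβ T
  positivity

theorem continuous_waveSlope {α β γ n ρ : ℝ} (hα : 0 < α) (hγ : 0 < γ) (hn : 0 < n)
    (hαβ : 0 < α + β) (hρ : 0 < ρ) : Continuous (waveSlope α β γ n ρ) := by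
  have hg := continuous_epsSecant α β n hγ
  have hg' := continuous_epsSecantDeriv α n hγ
  have hd : Continuous (deriv (eps α β γ n)) := by
    rw [funext (deriv_eps α β n hγ)]
    fun_prop
  refine Continuous.if_le (by fun_prop) (continuous_shockSlope hα hγ hn hαβ hρ)
    continuous_id continuous_const ?_
  intro T hT
  replace hT : T = 0 := hT
  rw [hT, deriv_eps_zero α β n hγ, shockSlope_zero γ n hαβ hρ]

theorem waveSlope_pos {α β γ n ρ : ℝ} (hα : 0 < α) (hγ : 0 < γ) (hn : 0 < n)
    (hαβ : 0 < α + β) (hρ : 0 < ρ) (T : ℝ) : 0 < waveSlope α β γ n ρ T := by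
  have hg := epsSecant_pos hα hγ hn hαβ T
  have hg' := mul_epsSecantDeriv_nonneg hα hγ hn T
  rw [waveSlope, shockSlope, deriv_eps α β n hγ]
  split_ifs <;> positivity

theorem sqrt_mul_eps_div (α β γ n ρ : ℝ) {T : ℝ} (hT : 0 ≤ T) :
    Real.sqrt (T * eps α β γ n T / ρ) = T * Real.sqrt (epsSecant α β γ n T / ρ) := by
  rw [eps_eq_mul_epsSecant, show T * (T * epsSecant α β γ n T) / ρ =
    T ^ 2 * (epsSecant α β γ n T / ρ) by ring, Real.sqrt_mul (sq_nonneg T),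
    Real.sqrt_sq hT]

theorem hasDerivAt_shockBranch {α β γ n ρ : ℝ} (hα : 0 < α) (hγ : 0 < γ) (hn : 0 < n)
    (hαβ : 0 < α + β) (hρ : 0 < ρ) (T : ℝ) :
    HasDerivAt (fun T => T * Real.sqrt (epsSecant α β γ n T / ρ))
      (shockSlope α β γ n ρ T) T := by
  have hg := epsSecant_pos hα hγ hn hαβ T
  refine ((hasDerivAt_id T).mul (((hasDerivAt_epsSecant α β n hγ T).div_const ρ).sqrt
    (div_pos hg hρ).ne')).congr_deriv ?_
  have hs := Real.sqrt_pos.2 hg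
  have hr := Real.sqrt_pos.2 hρ
  rw [shockSlope, Real.sqrt_mul hρ.le, Real.sqrt_div hg.le, id_eq]
  field_simp
  rw [Real.sq_sqrt hg.le, Real.sq_sqrt hρ.le]
  field_simp

theorem W2_eq_sub_integral {α β γ n ρ : ℝ} (Tl vl : ℝ) (hα : 0 < α) (hγ : 0 < γ)
    (hn : 0 < n) (hαβ : 0 < α + β) (hρ : 0 < ρ) (hTl : Tl < 0) (T : ℝ) :
    W2 α β γ n ρ Tl vl T = vl - ∫ τ in Tl..T, waveSlope α β γ n ρ τ := by
  have hw := continuous_waveSlope hα hγ hn hαβ hρ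
  have hleft : ∀ b ≤ (0 : ℝ), ∫ τ in Tl..b, Real.sqrt (deriv (eps α β γ n) τ / ρ) =
      ∫ τ in Tl..b, waveSlope α β γ n ρ τ := fun b hb =>
    intervalIntegral.integral_congr fun τ hτ =>
      (if_pos (hτ.2.trans (max_le hTl.le hb))).symm
  rw [W2]
  split_ifs with hT
  · rw [hleft T hT]
  · replace hT := not_le.1 hT
    have hright : ∫ τ in (0 : ℝ)..T, waveSlope α β γ n ρ τ =
        ∫ τ in (0 : ℝ)..T, shockSlope α β γ n ρ τ := by
      refine intervalIntegral.integral_congr_ae (.of_forall fun τ hτ => ?_)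
      rw [Set.uIoc_of_le hT.le] at hτ
      exact if_neg (not_le.2 hτ.1)
    rw [hleft 0 le_rfl, sqrt_mul_eps_div α β γ n ρ hT.le,
      ← intervalIntegral.integral_add_adjacent_intervals (hw.intervalIntegrable Tl 0)
        (hw.intervalIntegrable 0 T), hright,
      intervalIntegral.integral_eq_sub_of_hasDerivAt
        (fun τ _ => hasDerivAt_shockBranch hα hγ hn hαβ hρ τ)
        ((continuous_shockSlope hα hγ hn hαβ hρ).intervalIntegrable 0 T)]
    ring

theorem hasDerivAt_W2 {α β γ n ρ Tl : ℝ} (vl : ℝ) (hα : 0 < α) (hγ : 0 < γ)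
    (hn : 0 < n) (hαβ : 0 < α + β) (hρ : 0 < ρ) (hTl : Tl < 0) (T : ℝ) :
    HasDerivAt (W2 α β γ n ρ Tl vl) (-waveSlope α β γ n ρ T) T := by
  rw [funext (W2_eq_sub_integral Tl vl hα hγ hn hαβ hρ hTl)]
  exact ((continuous_waveSlope hα hγ hn hαβ hρ).integral_hasStrictDerivAt
    Tl T).hasDerivAt.const_sub vl

/-- Regularity and monotonicity of the composite forward wave curve: `W₂` is
continuous, strictly decreasing and continuously differentiable on `(T_l, ∞)`;
in particular it is differentiable at `T = 0` with `W₂'(0) = −√((α+β)/ρ)`,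
i.e. the left derivative `−√(ε'(0)/ρ)` and the right derivative
`lim_{T→0⁺} −(ε(T) + T ε'(T))/(2√(ρ T ε(T)))` coincide. -/
theorem stmt_17 (α β γ n ρ Tl vl : ℝ) (hα : 0 < α) (hβ : β < 0) (hγ : 0 < γ)
    (hn : 0 < n) (hαβ : 0 < α + β) (hρ : 0 < ρ) (hTl : Tl < 0) :
    ContinuousOn (W2 α β γ n ρ Tl vl) (Set.Ioi Tl) ∧
    StrictAntiOn (W2 α β γ n ρ Tl vl) (Set.Ioi Tl) ∧
    ContDiffOn ℝ 1 (W2 α β γ n ρ Tl vl) (Set.Ioi Tl) ∧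
    HasDerivAt (W2 α β γ n ρ Tl vl) (-Real.sqrt ((α + β) / ρ)) 0 ∧
    -Real.sqrt (deriv (eps α β γ n) 0 / ρ) = -Real.sqrt ((α + β) / ρ) ∧
    Filter.Tendsto
      (fun T => -((eps α β γ n T + T * deriv (eps α β γ n) T) /
        (2 * Real.sqrt (ρ * (T * eps α β γ n T)))))
      (nhdsWithin 0 (Set.Ioi 0)) (nhds (-Real.sqrt ((α + β) / ρ))) := by
  have hd := hasDerivAt_W2 vl hα hγ hn hαβ hρ hTl
  have hderiv : deriv (W2 α β γ n ρ Tl vl) = fun T => -waveSlope α β γ n ρ T :=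
    funext fun T => (hd T).deriv
  have hC1 : ContDiff ℝ 1 (W2 α β γ n ρ Tl vl) := by
    rw [contDiff_one_iff_deriv, hderiv]
    exact ⟨fun T => (hd T).differentiableAt, (continuous_waveSlope hα hγ hn hαβ hρ).neg⟩
  refine ⟨hC1.continuous.continuousOn, ?_, hC1.contDiffOn, ?_, ?_, ?_⟩
  · refine (strictAnti_of_deriv_neg fun T => ?_).strictAntiOn _
    rw [hderiv]
    exact neg_neg_of_pos (waveSlope_pos hα hγ hn hαβ hρ T)
  · convert hd 0 using 2
    rw [waveSlope, if_pos le_rfl, deriv_eps_zero α β n hγ]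
  · rw [deriv_eps_zero α β n hγ]
  · have h := (continuous_shockSlope hα hγ hn hαβ hρ).neg.tendsto 0
    rw [Pi.neg_apply, shockSlope_zero γ n hαβ hρ] at h
    refine (h.mono_left nhdsWithin_le_nhds).congr' ?_
    filter_upwards [self_mem_nhdsWithin] with T hT
    replace hT : 0 < T := hT
    rw [Pi.neg_apply, deriv_eps α β n hγ, eps_eq_mul_epsSecant, shockSlope,
      show ρ * (T * (T * epsSecant α β γ n T)) = T ^ 2 * (ρ * epsSecant α β γ n T) by ring,
      Real.sqrt_mul (sq_nonneg T), Real.sqrt_sq hT.le]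
    have hs := Real.sqrt_pos.2 (mul_pos hρ (epsSecant_pos hα hγ hn hαβ T))
    field_simp
    ring
end
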